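/- For all p, q, r ∈ (0, 1/36), the attractor K = K_pqr satisfies K ⊆ [0,1], {0,1} ⊆ K, and h ∈ K_3 ∩ K_4, where h = 8/15; moreover the only pair of distinct indices i ≠ j for which K_i ∩ K_j can be nonempty is {3,4}, i.e. K_i ∩ K_j = ∅ whenever {i,j} ≠ {3,4}. -/

import Mathlib

open Set

/-- The system `S_pqr = {S_1,…,S_6}` of similarities of `ℝ` (0-indexed: index `i : Fin 6`
corresponds to `S_{i+1}`), with `a = 1/5` and `h = 8/15`. -/
noncomputable def Spqr (p q r : ℝ) : Fin 6 → ℝ → ℝ :=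
  ![fun x => p * x,
    fun x => 1/5 + r * x,
    fun x => 8/15 - q * x,
    fun x => 8/15 - r + r * x,
    fun x => 1 - 1/5 - r * x,
    fun x => 1 - r + r * x]

/-- `K` is the attractor of the system `T`. -/
def IsAttractor (T : Fin 6 → ℝ → ℝ) (K : Set ℝ) : Prop :=
  K.Nonempty ∧ IsCompact K ∧ K = ⋃ i, T i '' K

/-- The pieces of a subset of `[0,1]` lie in explicit intervals. -/
theorem Spqr_image_bounds {p q r : ℝ} (hp : p ∈ Ioo (0:ℝ) (1/36)) (hq : q ∈ Ioo (0:ℝ) (1/36))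
    (hr : r ∈ Ioo (0:ℝ) (1/36)) {y : ℝ} (hy : y ∈ Icc (0:ℝ) 1) (i : Fin 6) :
    Spqr p q r i y ∈
      Icc ((![0, 1/5, 1/2, 1/2, 3/4, 19/20] : Fin 6 → ℝ) i)
        ((![1/10, 1/4, 8/15, 8/15, 4/5, 1] : Fin 6 → ℝ) i) := by
  obtain ⟨hp0, hp1⟩ := hp
  obtain ⟨hq0, hq1⟩ := hq
  obtain ⟨hr0, hr1⟩ := hr
  obtain ⟨hy0, hy1⟩ := hy
  have p0 := mul_nonneg hp0.le hy0
  have q0 := mul_nonneg hq0.le hy0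
  have r0 := mul_nonneg hr0.le hy0
  have p1 := mul_le_of_le_one_right hp0.le hy1
  have q1 := mul_le_of_le_one_right hq0.le hy1
  have r1 := mul_le_of_le_one_right hr0.le hy1
  fin_cases i <;> simp [Spqr] <;> constructor <;> linarith

/-- The attractor of `S_pqr` lies in `[0,1]`. -/
theorem IsAttractor.subset_Icc {p q r : ℝ} (hp : p ∈ Ioo (0:ℝ) (1/36))
    (hq : q ∈ Ioo (0:ℝ) (1/36)) (hr : r ∈ Ioo (0:ℝ) (1/36)) {K : Set ℝ}
    (hK : IsAttractor (Spqr p q r) K) : K ⊆ Icc 0 1 := by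
  obtain ⟨hne, hc, heq⟩ := hK
  obtain ⟨x, hx, hmax⟩ := hc.exists_isMaxOn hne
    (f := fun x : ℝ => |x - 1/2|) (by fun_prop)
  have hle : |x - 1/2| ≤ 1/2 := by
    by_contra! hR
    rw [heq] at hx
    obtain ⟨i, y, hy, rfl⟩ := mem_iUnion.1 hx
    have hyR : |y - 1/2| ≤ |Spqr p q r i y - 1/2| := hmax hy
    set R := |Spqr p q r i y - 1/2| with hRdef
    obtain ⟨hp0, hp1⟩ := hp
    obtain ⟨hq0, hq1⟩ := hq
    obtain ⟨hr0, hr1⟩ := hr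
    obtain ⟨h1, h2⟩ := abs_le.1 hyR
    have key (c : ℝ) (h0 : 0 < c) (hc1 : c < 1/36) :
        -(c * R) ≤ c * (y - 1/2) ∧ c * (y - 1/2) ≤ c * R ∧
          0 < (1 - c) * (R - 1/2) :=
      ⟨by nlinarith, by nlinarith, mul_pos (by linarith) (by linarith)⟩
    obtain ⟨p1, p2, p3⟩ := key p hp0 hp1
    obtain ⟨q1, q2, q3⟩ := key q hq0 hq1
    obtain ⟨r1, r2, r3⟩ := key r hr0 hr1
    have : R < R := by
      conv_lhs => rw [hRdef]
      clear_value R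
      rw [abs_lt]
      clear hmax hx hRdef
      fin_cases i <;> simp [Spqr] <;> constructor <;> linarith
    exact lt_irrefl _ this
  intro z hz
  obtain ⟨h1, h2⟩ := abs_le.1 ((show |z - 1/2| ≤ |x - 1/2| from hmax hz).trans hle)
  exact ⟨by linarith, by linarith⟩

/-- For all `p, q, r ∈ (0,1/36)` the attractor `K` of `S_pqr` satisfies `K ⊆ [0,1]`,
`{0,1} ⊆ K`, `h = 8/15 ∈ K₃ ∩ K₄` (indices `2, 3` here), and all other pairwise
intersections of distinct pieces are empty. -/
theorem stmt9 (p q r : ℝ) (hp : p ∈ Ioo (0:ℝ) (1/36)) (hq : q ∈ Ioo (0:ℝ) (1/36))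
    (hr : r ∈ Ioo (0:ℝ) (1/36)) (K : Set ℝ) (hK : IsAttractor (Spqr p q r) K) :
    K ⊆ Icc 0 1 ∧ (0:ℝ) ∈ K ∧ (1:ℝ) ∈ K ∧
      (8/15 : ℝ) ∈ (Spqr p q r 2 '' K) ∩ (Spqr p q r 3 '' K) ∧
      ∀ i j : Fin 6, i ≠ j → ({i, j} : Set (Fin 6)) ≠ {2, 3} →
        (Spqr p q r i '' K) ∩ (Spqr p q r j '' K) = ∅ := by
  have hsub := hK.subset_Icc hp hq hr
  obtain ⟨hne, hc, heq⟩ := hK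
  have hmem (i : Fin 6) {y : ℝ} (hy : y ∈ K) : Spqr p q r i y ∈ K := by
    rw [heq]
    exact mem_iUnion.2 ⟨i, y, hy, rfl⟩
  have h0 : (0:ℝ) ∈ K := by
    obtain ⟨m, hm, hmin⟩ := hc.exists_isLeast hne
    have h : m ≤ p * m := hmin (hmem 0 hm)
    have hm0 : m = 0 := by nlinarith [(hsub hm).1, hp.2]
    exact hm0 ▸ hm
  have h1 : (1:ℝ) ∈ K := by
    obtain ⟨m, hm, hmax⟩ := hc.exists_isGreatest hne
    have h : 1 - r + r * m ≤ m := hmax (hmem 5 hm)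
    have hm1 : m = 1 := by nlinarith [(hsub hm).2, hr.2]
    exact hm1 ▸ hm
  refine ⟨hsub, h0, h1, ⟨⟨0, h0, by simp [Spqr]⟩, ⟨1, h1, by simp [Spqr]⟩⟩, ?_⟩
  intro i j hij hne'
  rw [eq_empty_iff_forall_notMem]
  rintro _ ⟨⟨y, hy, rfl⟩, ⟨z, hz, hzy⟩⟩
  obtain ⟨a1, a2⟩ := Spqr_image_bounds hp hq hr (hsub hy) i
  obtain ⟨b1, b2⟩ := Spqr_image_bounds hp hq hr (hsub hz) j
  rw [hzy] at b1 b2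
  have hlo := b1.trans a2
  have hhi := a1.trans b2
  clear a1 a2 b1 b2 hzy
  fin_cases i <;> fin_cases j <;>
    first
    | exact hij rfl
    | exact hne' rfl
    | exact hne' (pair_comm _ _)
    | (refine absurd hlo ?_; norm_num; done)
    | (refine absurd hhi ?_; norm_num)
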